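/- arXiv:1910.11120 — 2 statements merged into one kernel-verified Lean document; each statement's English description precedes it below -/
import Mathlib

section
/- Let x and C be skew-symmetric n×n complex matrices. Then tr(C·(Y·x + x·Yᵀ)) = 0 for every n×n complex matrix Y if and only if x·C = 0. (This identifies the conormal space at x to the GL(n,ℂ)-orbit {g·x·gᵀ} inside the space of skew-symmetric matrices, under the trace pairing.) -/
open Matrix

/-- For skew-symmetric n×n complex matrices `x` and `C`, one has
`tr(C·(Y·x + x·Yᵀ)) = 0` for every n×n complex matrix `Y` iff `x·C = 0`. -/
theorem conormal_skew_orbit (n : ℕ) (x C : Matrix (Fin n) (Fin n) ℂ)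
    (hx : xᵀ = -x) (hC : Cᵀ = -C) :
    (∀ Y : Matrix (Fin n) (Fin n) ℂ, (C * (Y * x + x * Yᵀ)).trace = 0) ↔ x * C = 0 := by
  have key : ∀ Y : Matrix (Fin n) (Fin n) ℂ,
      (C * (Y * x + x * Yᵀ)).trace = 2 * (x * C * Y).trace := by
    intro Y
    have h1 : (C * (Y * x)).trace = (x * C * Y).trace := by
      rw [← Matrix.mul_assoc, Matrix.trace_mul_comm, ← Matrix.mul_assoc]
    have h2 : (C * (x * Yᵀ)).trace = (x * C * Y).trace := by
      rw [← Matrix.trace_transpose, Matrix.transpose_mul, Matrix.transpose_mul,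
        Matrix.transpose_transpose, hx, hC, Matrix.mul_neg, Matrix.mul_neg, Matrix.neg_mul,
        neg_neg, Matrix.mul_assoc, Matrix.trace_mul_comm]
    rw [Matrix.mul_add, Matrix.trace_add, h1, h2, two_mul]
  constructor
  · intro h
    have h0 := h (x * C)ᴴ
    rw [key] at h0
    have h1 : (x * C * (x * C)ᴴ).trace = 0 := by simpa using h0
    open scoped ComplexOrder in
    exact Matrix.trace_mul_conjTranspose_self_eq_zero_iff.mp h1
  · intro h Y
    rw [key, h]
    simp
end

section
/- Let B be a nondegenerate symmetric bilinear form on ℂⁿ and let U, U' ⊆ ℂⁿ be subspaces with dim U = dim U' = k. Then there exists an isometry g of B with g(U) = U' if and only if dim rad(B|_U) = dim rad(B|_{U'}). (This classifies the orbits Q(i) of the orthogonal group O(n) on the Grassmannian Gr(k,n): Q(i) = {U : dim rad(B|_U) = i}.) -/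
open Module

/-- The radical `rad(B|_U) = {u ∈ U : B(u,v) = 0 for all v ∈ U}` of the restriction
of the bilinear form `B` to the subspace `U`. -/
def radRestrict {V : Type*} [AddCommGroup V] [Module ℂ V]
    (B : LinearMap.BilinForm ℂ V) (U : Submodule ℂ V) : Submodule ℂ V :=
  U ⊓ LinearMap.ker (B.compl₂ U.subtype)

/-- Prescribing pairings with an independent family. -/
lemma exists_pairing {V : Type*} [AddCommGroup V] [Module ℂ V] [FiniteDimensional ℂ V]
    (B : LinearMap.BilinForm ℂ V) (hnd : ∀ v, (∀ w, B v w = 0) → v = 0)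
    {ι : Type} [Fintype ι] (y : ι → V) (hy : LinearIndependent ℂ y) (c : ι → ℂ) :
    ∃ v, ∀ i, B v (y i) = c i := by
  have hinj : Function.Injective B := by
    rw [← LinearMap.ker_eq_bot, LinearMap.ker_eq_bot']
    intro v hv
    exact hnd v fun w => by rw [hv]; rfl
  have hsurj : Function.Surjective B :=
    (LinearMap.injective_iff_surjective_of_finrank_eq_finrank
      (Subspace.dual_finrank_eq (K := ℂ) (V := V)).symm).1 hinj
  let b := Basis.span hy
  obtain ⟨φ, hφ⟩ := LinearMap.exists_extend (b.constr ℂ c)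
  obtain ⟨v, hv⟩ := hsurj φ
  refine ⟨v, fun i => ?_⟩
  have h1 := LinearMap.congr_fun hφ (b i)
  rw [Basis.constr_basis] at h1
  rw [hv, ← h1]
  simp [b, Basis.span_apply]

lemma exists_unit_perp {V : Type*} [AddCommGroup V] [Module ℂ V] [FiniteDimensional ℂ V]
    (B : LinearMap.BilinForm ℂ V) (hs : ∀ v w, B v w = B w v)
    (hnd : ∀ v, (∀ w, B v w = 0) → v = 0)
    {ι : Type} [Fintype ι] (x : ι → V) (hc : Fintype.card ι < finrank ℂ V)
    (hr : ∀ a : ι → ℂ, (∀ j, B (∑ i, a i • x i) (x j) = 0) → a = 0) :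
    ∃ v, (∀ i, B v (x i) = 0) ∧ B v v = 1 ∧ v ∉ Submodule.span ℂ (Set.range x) := by
  let T : V →ₗ[ℂ] (ι → ℂ) := LinearMap.pi fun j => B.flip (x j)
  have hT : ∀ v j, T v j = B v (x j) := fun v j => rfl
  let S : (ι → ℂ) →ₗ[ℂ] (ι → ℂ) := T ∘ₗ Fintype.linearCombination ℂ x
  have hS : ∀ a j, S a j = B (∑ i, a i • x i) (x j) := fun a j => by
    simp only [S, LinearMap.comp_apply, Fintype.linearCombination_apply, hT]
  have hinj : Function.Injective S := by
    rw [← LinearMap.ker_eq_bot, LinearMap.ker_eq_bot']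
    intro a ha
    exact hr a fun j => by rw [← hS, ha]; rfl
  have hsurj := LinearMap.injective_iff_surjective.1 hinj
  have hdec : ∀ v, ∃ a : ι → ℂ, ∀ j, B (v - ∑ i, a i • x i) (x j) = 0 := by
    intro v
    obtain ⟨a, ha⟩ := hsurj (T v)
    refine ⟨a, fun j => ?_⟩
    have := congrFun ha j
    rw [hS, hT] at this
    rw [map_sub, LinearMap.sub_apply, this, sub_self]
  have hmem : ∀ a : ι → ℂ, ∑ i, a i • x i ∈ Submodule.span ℂ (Set.range x) := fun a =>
    Submodule.sum_mem _ fun i _ => Submodule.smul_mem _ _ (Submodule.subset_span ⟨i, rfl⟩)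
  have hout : ∀ v, (∀ j, B v (x j) = 0) → v ≠ 0 → v ∉ Submodule.span ℂ (Set.range x) := by
    intro v h0 hne hv
    obtain ⟨a, rfl⟩ := (Submodule.mem_span_range_iff_exists_fun ℂ).1 hv
    apply hne
    rw [hr a h0]; simp
  have key : ∃ v, (∀ j, B v (x j) = 0) ∧ B v v ≠ 0 := by
    by_contra! hcon
    have hlt : Submodule.span ℂ (Set.range x) ≠ ⊤ := by
      intro h
      have := finrank_range_le_card (R := ℂ) x
      rw [Set.finrank, h, finrank_top] at this
      omega
    obtain ⟨v, hv⟩ : ∃ v, v ∉ Submodule.span ℂ (Set.range x) := by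
      by_contra! h
      exact hlt (Submodule.eq_top_iff'.2 h)
    obtain ⟨a, ha⟩ := hdec v
    set z := v - ∑ i, a i • x i with hz
    have hz0 : z = 0 := by
      apply hnd
      intro w
      obtain ⟨b, hb⟩ := hdec w
      set t := w - ∑ i, b i • x i with ht
      have hw : w = t + ∑ i, b i • x i := by rw [ht]; abel
      have h1 := hcon z ha
      have h2 := hcon t hb
      have h3 := hcon (z + t) (fun j => by rw [map_add, LinearMap.add_apply, ha, hb, add_zero])
      simp only [map_add, LinearMap.add_apply, h1, h2, hs t z] at h3
      have h4 : B z t = 0 := by linear_combination h3 / 2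
      rw [hw, map_add, h4, map_sum]
      simp [ha]
    apply hv
    have : v = ∑ i, a i • x i := by rw [← sub_eq_zero, ← hz, hz0]
    rw [this]; exact hmem a
  obtain ⟨v, h0, hne⟩ := key
  obtain ⟨s, hs2⟩ := IsAlgClosed.exists_pow_nat_eq (B v v)⁻¹ (n := 2) (by norm_num)
  have h1 : B (s • v) (s • v) = 1 := by
    simp only [map_smul, LinearMap.smul_apply, smul_eq_mul]
    rw [← mul_assoc, ← sq, hs2, inv_mul_cancel₀ hne]
  have h2 : ∀ j, B (s • v) (x j) = 0 := fun j => by simp [h0]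
  refine ⟨s • v, h2, h1, hout _ h2 ?_⟩
  intro h; rw [h] at h1; simp at h1

lemma step_extend {V V' : Type*} [AddCommGroup V] [Module ℂ V] [FiniteDimensional ℂ V]
    [AddCommGroup V'] [Module ℂ V'] [FiniteDimensional ℂ V']
    (B : LinearMap.BilinForm ℂ V) (hs : ∀ v w, B v w = B w v)
    (hnd : ∀ v, (∀ w, B v w = 0) → v = 0)
    (B' : LinearMap.BilinForm ℂ V') (hs' : ∀ v w, B' v w = B' w v)
    (hnd' : ∀ v, (∀ w, B' v w = 0) → v = 0)
    {ι : Type} [Fintype ι] (x : ι → V) (y : ι → V')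
    (hx : LinearIndependent ℂ x) (hy : LinearIndependent ℂ y)
    (hxy : ∀ i j, B (x i) (x j) = B' (y i) (y j))
    (hc : Fintype.card ι < finrank ℂ V) (hc' : Fintype.card ι < finrank ℂ V') :
    ∃ v v', (∀ i, B v (x i) = B' v' (y i)) ∧ B v v = B' v' v' ∧
      v ∉ Submodule.span ℂ (Set.range x) ∧ v' ∉ Submodule.span ℂ (Set.range y) := by
  have hG : ∀ (a : ι → ℂ) j, B (∑ i, a i • x i) (x j) = B' (∑ i, a i • y i) (y j) := by
    intro a j
    simp [hxy]
  by_cases hr : ∀ a : ι → ℂ, (∀ j, B (∑ i, a i • x i) (x j) = 0) → a = 0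
  · obtain ⟨v, h1, h2, h3⟩ := exists_unit_perp B hs hnd x hc hr
    obtain ⟨v', h1', h2', h3'⟩ := exists_unit_perp B' hs' hnd' y hc'
      (fun a h => hr a fun j => by rw [hG, h])
    exact ⟨v, v', fun i => by rw [h1, h1'], by rw [h2, h2'], h3, h3'⟩
  · push Not at hr
    obtain ⟨a, ha, hne⟩ := hr
    have ha' : ∀ j, B' (∑ i, a i • y i) (y j) = 0 := fun j => by rw [← hG, ha]
    set r := ∑ i, a i • x i with hrdef
    set r' := ∑ i, a i • y i with hrdef'
    have hr0 : r ≠ 0 := fun h => hne (funext (Fintype.linearIndependent_iff.1 hx a h))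
    obtain ⟨v, hv⟩ : ∃ v, B r v ≠ 0 := by
      by_contra! h
      exact hr0 (hnd r h)
    obtain ⟨w, hw⟩ := exists_pairing B' hnd' y hy (fun i => B v (x i))
    have hwr : B' w r' = B r v := by
      rw [hs, hrdef, hrdef']
      simp [hw]
    have hrr : B' r' r' = 0 := by
      conv_lhs => rw [hrdef', map_sum]
      simp [← hrdef', ha']
    let c := (B v v - B' w w) / (2 * B r v)
    have hperp : ∀ z ∈ Submodule.span ℂ (Set.range x), B r z = 0 := by
      intro z hz
      obtain ⟨b, rfl⟩ := (Submodule.mem_span_range_iff_exists_fun ℂ).1 hz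
      simp [ha]
    have hperp' : ∀ z ∈ Submodule.span ℂ (Set.range y), B' r' z = 0 := by
      intro z hz
      obtain ⟨b, rfl⟩ := (Submodule.mem_span_range_iff_exists_fun ℂ).1 hz
      simp [ha']
    refine ⟨v, w + c • r', fun i => ?_, ?_, fun h => hv (hperp v h), fun h => ?_⟩
    · simp [hw, ha']
    · simp only [map_add, LinearMap.add_apply, map_smul, LinearMap.smul_apply, smul_eq_mul, hrr,
        hs' r' w, hwr, c]
      field_simp
      ring
    · have := hperp' _ h
      rw [map_add, map_smul, hrr, hs', hwr] at this
      simp at this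
      exact hv this

lemma witt_extend {V V' : Type*} [AddCommGroup V] [Module ℂ V] [FiniteDimensional ℂ V]
    [AddCommGroup V'] [Module ℂ V'] [FiniteDimensional ℂ V']
    (B : LinearMap.BilinForm ℂ V) (hs : ∀ v w, B v w = B w v)
    (hnd : ∀ v, (∀ w, B v w = 0) → v = 0)
    (B' : LinearMap.BilinForm ℂ V') (hs' : ∀ v w, B' v w = B' w v)
    (hnd' : ∀ v, (∀ w, B' v w = 0) → v = 0)
    (hdim : finrank ℂ V = finrank ℂ V') (d : ℕ) :
    ∀ {ι : Type} [Fintype ι] (x : ι → V) (y : ι → V')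
    (_ : LinearIndependent ℂ x) (_ : LinearIndependent ℂ y)
    (_ : ∀ i j, B (x i) (x j) = B' (y i) (y j))
    (_ : Fintype.card ι + d = finrank ℂ V),
    ∃ g : V ≃ₗ[ℂ] V', (∀ v w, B' (g v) (g w) = B v w) ∧ ∀ i, g (x i) = y i := by
  induction d with
  | zero =>
    intro ι _ x y hx hy hxy hc
    let b := basisOfLinearIndependentOfCardEqFinrank' x hx hc
    let b' := basisOfLinearIndependentOfCardEqFinrank' y hy (hc.trans hdim)
    have hb : ∀ i, b i = x i := fun i => by simp [b]
    have hb' : ∀ i, b' i = y i := fun i => by simp [b']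
    let g := b.equiv b' (Equiv.refl ι)
    have hg : ∀ i, g (b i) = b' i := fun i => by simp [g]
    refine ⟨g, ?_, fun i => by rw [← hb, hg, hb']⟩
    have : B'.compl₁₂ (g : V →ₗ[ℂ] V') (g : V →ₗ[ℂ] V') = B := by
      refine b.ext fun i => b.ext fun j => ?_
      simp only [LinearMap.compl₁₂_apply, LinearEquiv.coe_coe, hg]
      rw [hb, hb, hb', hb', hxy]
    intro v w
    rw [← LinearMap.congr_fun (LinearMap.congr_fun this v) w]
    rfl
  | succ d ih =>
    intro ι _ x y hx hy hxy hc
    obtain ⟨v, v', h1, h2, h3, h4⟩ := step_extend B hs hnd B' hs' hnd' x y hx hy hxy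
      (by omega) (by omega)
    obtain ⟨g, hg, hg'⟩ := ih (ι := Option ι) (fun o => o.casesOn' v x) (fun o => o.casesOn' v' y)
      (linearIndependent_option'.2 ⟨hx, h3⟩) (linearIndependent_option'.2 ⟨hy, h4⟩)
      (by
        rintro (_ | i) (_ | j)
        · exact h2
        · exact h1 j
        · simpa [hs _ v, hs' _ v'] using h1 i
        · exact hxy i j)
      (by rw [Fintype.card_option]; omega)
    exact ⟨g, hg, fun i => hg' (some i)⟩

lemma mem_radRestrict {V : Type*} [AddCommGroup V] [Module ℂ V]
    (B : LinearMap.BilinForm ℂ V) (U : Submodule ℂ V) (v : V) :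
    v ∈ radRestrict B U ↔ v ∈ U ∧ ∀ u ∈ U, B v u = 0 := by
  simp only [radRestrict, Submodule.mem_inf, LinearMap.mem_ker]
  refine and_congr_right fun _ => ⟨fun h u hu => LinearMap.congr_fun h ⟨u, hu⟩, fun h => ?_⟩
  ext u
  exact h u u.2

/-- A complement of the radical. -/
lemma exists_compl_rad {V : Type*} [AddCommGroup V] [Module ℂ V] [FiniteDimensional ℂ V]
    (B : LinearMap.BilinForm ℂ V) (hs : ∀ v w, B v w = B w v) (U : Submodule ℂ V) :
    ∃ W : Submodule ℂ V, Disjoint (radRestrict B U) W ∧ radRestrict B U ⊔ W = U ∧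
      finrank ℂ (radRestrict B U) + finrank ℂ W = finrank ℂ U ∧
      (∀ v : W, (∀ w : W, B v w = 0) → v = 0) := by
  have hle : radRestrict B U ≤ U := inf_le_left
  obtain ⟨W, hW⟩ := exists_isCompl (radRestrict B U)
  have hdis : Disjoint (radRestrict B U) (W ⊓ U) := hW.disjoint.mono_right inf_le_left
  have hsup : radRestrict B U ⊔ (W ⊓ U) = U := by
    rw [sup_inf_assoc_of_le W hle |>.symm, hW.sup_eq_top, top_inf_eq]
  refine ⟨W ⊓ U, hdis, hsup, ?_, ?_⟩
  · have := Submodule.finrank_sup_add_finrank_inf_eq (radRestrict B U) (W ⊓ U)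
    rw [hsup, hdis.eq_bot, finrank_bot] at this
    omega
  · intro v hv
    have h1 : (v : V) ∈ radRestrict B U := by
      rw [mem_radRestrict]
      refine ⟨v.2.2, fun u hu => ?_⟩
      rw [← hsup] at hu
      obtain ⟨r, hr, w, hw, rfl⟩ := Submodule.mem_sup.1 hu
      rw [map_add, hv ⟨w, hw⟩, hs, ((mem_radRestrict B U r).1 hr).2 v v.2.2, add_zero]
    exact Subtype.ext (Submodule.disjoint_def.1 hdis v h1 v.2)

theorem orthogonal_orbit_classification (n k : ℕ)
    (B : LinearMap.BilinForm ℂ (Fin n → ℂ))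
    (hsymm : ∀ v w, B v w = B w v)
    (hnd : radRestrict B ⊤ = ⊥)
    (U U' : Submodule ℂ (Fin n → ℂ))
    (hU : finrank ℂ U = k) (hU' : finrank ℂ U' = k) :
    (∃ g : (Fin n → ℂ) ≃ₗ[ℂ] (Fin n → ℂ),
        (∀ v w, B (g v) (g w) = B v w) ∧
        Submodule.map (g : (Fin n → ℂ) →ₗ[ℂ] (Fin n → ℂ)) U = U') ↔
      finrank ℂ (radRestrict B U) = finrank ℂ (radRestrict B U') := by
  constructor
  · rintro ⟨g, hg, rfl⟩
    have : radRestrict B (Submodule.map (g : (Fin n → ℂ) →ₗ[ℂ] (Fin n → ℂ)) U) =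
        Submodule.map (g : (Fin n → ℂ) →ₗ[ℂ] (Fin n → ℂ)) (radRestrict B U) := by
      ext v
      simp only [mem_radRestrict, Submodule.mem_map]
      constructor
      · rintro ⟨⟨u, hu, rfl⟩, h⟩
        exact ⟨u, ⟨hu, fun w hw => by rw [← hg]; exact h _ ⟨w, hw, rfl⟩⟩, rfl⟩
      · rintro ⟨u, ⟨hu, h⟩, rfl⟩
        refine ⟨⟨u, hu, rfl⟩, ?_⟩
        rintro _ ⟨w, hw, rfl⟩
        exact (hg u w).trans (h w hw)
    rw [this]
    exact (LinearEquiv.finrank_map_eq g _).symm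
  · intro hrad
    have hnd1 : ∀ v, (∀ w, B v w = 0) → v = 0 := by
      intro v hv
      have : v ∈ radRestrict B ⊤ := (mem_radRestrict B ⊤ v).2 ⟨trivial, fun w _ => hv w⟩
      rwa [hnd, Submodule.mem_bot] at this
    obtain ⟨W, hd, hsup, hf, hW⟩ := exists_compl_rad B hsymm U
    obtain ⟨W', hd', hsup', hf', hW'⟩ := exists_compl_rad B hsymm U'
    have hWW : finrank ℂ W = finrank ℂ W' := by omega
    obtain ⟨f, hf1, -⟩ := witt_extend (B.compl₁₂ W.subtype W.subtype)
      (fun v w => hsymm v w) hW (B.compl₁₂ W'.subtype W'.subtype)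
      (fun v w => hsymm v w) hW' hWW (finrank ℂ W) (ι := Empty) (fun e => e.elim)
      (fun e => e.elim) (linearIndependent_empty_type) (linearIndependent_empty_type)
      (fun e => e.elim) (by simp)
    have hf2 : ∀ v w : W, B (f v) (f w) = B v w := hf1
    let bR := finBasis ℂ (radRestrict B U)
    let bR' := (finBasis ℂ (radRestrict B U')).reindex (finCongr hrad.symm)
    let bW := finBasis ℂ W
    let bW' := bW.map f
    have span_of : ∀ {κ : Type} (S : Submodule ℂ (Fin n → ℂ)) (b : Basis κ ℂ S),
        Submodule.span ℂ (Set.range fun i => (b i : Fin n → ℂ)) = S := by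
      intro κ S b
      have := congrArg (Submodule.map S.subtype) b.span_eq
      rw [Submodule.map_span, ← Set.range_comp, Submodule.map_top, Submodule.range_subtype] at this
      exact this
    have li_of : ∀ {κ : Type} (S : Submodule ℂ (Fin n → ℂ)) (b : Basis κ ℂ S),
        LinearIndependent ℂ (fun i => (b i : Fin n → ℂ)) := by
      intro κ S b
      exact b.linearIndependent.map' S.subtype S.ker_subtype
    let x : Fin (finrank ℂ (radRestrict B U)) ⊕ Fin (finrank ℂ W) → (Fin n → ℂ) :=
      Sum.elim (fun i => (bR i : Fin n → ℂ)) (fun i => (bW i : Fin n → ℂ))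
    let y : Fin (finrank ℂ (radRestrict B U)) ⊕ Fin (finrank ℂ W) → (Fin n → ℂ) :=
      Sum.elim (fun i => (bR' i : Fin n → ℂ)) (fun i => (bW' i : Fin n → ℂ))
    have hx : LinearIndependent ℂ x := (li_of _ bR).sum_type (li_of _ bW)
      (by rw [span_of, span_of]; exact hd)
    have hy : LinearIndependent ℂ y := (li_of _ bR').sum_type (li_of _ bW')
      (by rw [span_of, span_of]; exact hd')
    have hxs : Submodule.span ℂ (Set.range x) = U := by
      rw [Set.Sum.elim_range, Submodule.span_union, span_of, span_of, hsup]
    have hys : Submodule.span ℂ (Set.range y) = U' := by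
      rw [Set.Sum.elim_range, Submodule.span_union, span_of, span_of, hsup']
    have hxU : ∀ i, x i ∈ U := fun i => hxs ▸ Submodule.subset_span ⟨i, rfl⟩
    have hyU : ∀ i, y i ∈ U' := fun i => hys ▸ Submodule.subset_span ⟨i, rfl⟩
    have hR : ∀ i j, B (x (Sum.inl i)) (x j) = 0 := fun i j =>
      ((mem_radRestrict B U _).1 (bR i).2).2 _ (hxU j)
    have hR' : ∀ i j, B (y (Sum.inl i)) (y j) = 0 := fun i j =>
      ((mem_radRestrict B U' _).1 (bR' i).2).2 _ (hyU j)
    have hxy : ∀ i j, B (x i) (x j) = B (y i) (y j) := by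
      rintro (i | i) j
      · rw [hR, hR']
      · rcases j with j | j
        · rw [hsymm, hR, hsymm, hR']
        · simpa [x, y, bW'] using (hf2 (bW i) (bW j)).symm
    have hcard := hx.fintype_card_le_finrank
    obtain ⟨g, hg, hgx⟩ := witt_extend B hsymm hnd1 B hsymm hnd1 rfl _ x y hx hy hxy
      (Nat.add_sub_of_le hcard)
    refine ⟨g, hg, ?_⟩
    rw [← hxs, ← hys, Submodule.map_span, ← Set.range_comp]
    congr 2
    exact funext hgx
end
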